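/- For any weighted graph G=(V,E,μ,w) with n vertices, the k-th min-max eigenvalue of the 1-Laplacian is bounded below by the k-th max-min Cheeger constant: inf over origin-symmetric compact S with γ(S) ≥ k of sup_{x∈S} Φ₁(x) ≥ ℓ_k(G), where ℓ_k(G) = max over subpartitions (A₁,…,A_{n-k+1}) of V of min_{B∈𝒰(A₁,…,A_{n-k+1})} φ(B). -/

import Mathlib

open Finset

variable {V : Type*}

noncomputable def bdryW [Fintype V] [DecidableEq V] (G : SimpleGraph V) [DecidableRel G.Adj]
    (w : Sym2 V → ℝ) (A : Finset V) : ℝ :=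
  ∑ u ∈ A, ∑ v ∈ Aᶜ, if G.Adj u v then w s(u, v) else 0

noncomputable def vol [Fintype V] (μ : V → ℝ) (A : Finset V) : ℝ := ∑ v ∈ A, μ v

noncomputable def phi [Fintype V] [DecidableEq V] (G : SimpleGraph V) [DecidableRel G.Adj]
    (μ : V → ℝ) (w : Sym2 V → ℝ) (A : Finset V) : ℝ := bdryW G w A / vol μ A

/-- A subpartition: a tuple of pairwise disjoint nonempty subsets of the vertex set. -/
def IsSubpartition {k : ℕ} (A : Fin k → Finset V) : Prop :=
  (∀ i, (A i).Nonempty) ∧ ∀ i j, i ≠ j → Disjoint (A i) (A j)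

/-- The Cheeger k-constant: min over subpartitions with k parts of the max expansion. -/
noncomputable def hkConst [Fintype V] [DecidableEq V] (G : SimpleGraph V) [DecidableRel G.Adj]
    (μ : V → ℝ) (w : Sym2 V → ℝ) (k : ℕ) : ℝ :=
  sInf {r | ∃ A : Fin k → Finset V, IsSubpartition A ∧
    r = sSup {s | ∃ i, s = phi G μ w (A i)}}

/-- Variant of the Cheeger k-constant where the maximum runs over all unions of parts. -/
noncomputable def hkUnion [Fintype V] [DecidableEq V] (G : SimpleGraph V) [DecidableRel G.Adj]
    (μ : V → ℝ) (w : Sym2 V → ℝ) (k : ℕ) : ℝ :=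
  sInf {r | ∃ A : Fin k → Finset V, IsSubpartition A ∧
    r = sSup {s | ∃ I : Finset (Fin k), I.Nonempty ∧ s = phi G μ w (I.biUnion A)}}

/-- The k-th max-min Cheeger constant ℓ_k. -/
noncomputable def ellk [Fintype V] [DecidableEq V] (G : SimpleGraph V) [DecidableRel G.Adj]
    (μ : V → ℝ) (w : Sym2 V → ℝ) (k : ℕ) : ℝ :=
  sSup {r | ∃ A : Fin (Fintype.card V - k + 1) → Finset V, IsSubpartition A ∧
    r = sInf {s | ∃ I : Finset (Fin (Fintype.card V - k + 1)), I.Nonempty ∧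
      s = phi G μ w (I.biUnion A)}}

/-- The Cheeger constant of a subset A: min of φ over nonempty subsets of A. -/
noncomputable def cheegerConst [Fintype V] [DecidableEq V] (G : SimpleGraph V) [DecidableRel G.Adj]
    (μ : V → ℝ) (w : Sym2 V → ℝ) (A : Finset V) : ℝ :=
  sInf {r | ∃ B : Finset V, B ⊆ A ∧ B.Nonempty ∧ r = phi G μ w B}

/-- The k-th Dirichlet Cheeger constant ℓ̲_k. -/
noncomputable def ellUnder [Fintype V] [DecidableEq V] (G : SimpleGraph V) [DecidableRel G.Adj]
    (μ : V → ℝ) (w : Sym2 V → ℝ) (k : ℕ) : ℝ :=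
  sSup {r | ∃ A : Finset V, A.card = Fintype.card V - k + 1 ∧ r = cheegerConst G μ w A}

/-- The L¹-Rayleigh quotient Φ₁. -/
noncomputable def Phi1 [Fintype V] [DecidableEq V] (G : SimpleGraph V) [DecidableRel G.Adj]
    (μ : V → ℝ) (w : Sym2 V → ℝ) (x : V → ℝ) : ℝ :=
  ((∑ u, ∑ v, if G.Adj u v then w s(u, v) * |x u - x v| else 0) / 2) / (∑ v, μ v * |x v|)

/-- The indicator vector of a finite set of vertices. -/
def indVec [DecidableEq V] (A : Finset V) : V → ℝ := fun v => if v ∈ A then 1 else 0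

/-- The Krasnoselskii genus: the least `m` such that there exists an odd continuous map
from `S` into `ℝᵐ \ {0}`. -/
noncomputable def genus [Fintype V] (S : Set (V → ℝ)) : ℕ :=
  sInf {m : ℕ | ∃ f : S → (Fin m → ℝ), Continuous f ∧ (∀ x, f x ≠ 0) ∧
    ∀ (x : V → ℝ) (hx : x ∈ S) (hx' : -x ∈ S), f ⟨-x, hx'⟩ = - f ⟨x, hx⟩}

/-- The k-th min-max eigenvalue of the graph 1-Laplacian (with index = Krasnoselskii genus). -/
noncomputable def lambdak [Fintype V] [DecidableEq V] (G : SimpleGraph V) [DecidableRel G.Adj]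
    (μ : V → ℝ) (w : Sym2 V → ℝ) (k : ℕ) : ℝ :=
  sInf {r | ∃ S : Set (V → ℝ), IsCompact S ∧ (∀ x ∈ S, -x ∈ S) ∧ k ≤ genus S ∧
    r = sSup (Phi1 G μ w '' S)}


namespace BU

variable {E : Type*}

/-- mod 2 chains on ordered tuples -/
abbrev Ch (E : Type*) := List E →₀ ZMod 2

noncomputable def cone (a : E) : Ch E →ₗ[ZMod 2] Ch E :=
  Finsupp.lmapDomain (ZMod 2) (ZMod 2) (List.cons a)

lemma cone_single (a : E) (l : List E) (r : ZMod 2) :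
    cone a (Finsupp.single l r) = Finsupp.single (a :: l) r := by
  simp [cone, Finsupp.mapDomain_single]

noncomputable def bdL : List E → Ch E
  | [] => 0
  | a :: l => Finsupp.single l 1 + cone a (bdL l)

noncomputable def bd : Ch E →ₗ[ZMod 2] Ch E := Finsupp.linearCombination (ZMod 2) bdL

lemma bd_single (l : List E) : bd (Finsupp.single l 1) = bdL l := by
  simp [bd, Finsupp.linearCombination_single]

lemma ext1 {M : Type*} [AddCommGroup M] [Module (ZMod 2) M] {f g : Ch E →ₗ[ZMod 2] M}
    (h : ∀ l, f (Finsupp.single l 1) = g (Finsupp.single l 1)) : f = g := by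
  apply Finsupp.lhom_ext'
  intro l
  apply LinearMap.ext_ring
  exact h l

lemma add_self' (c : Ch E) : c + c = 0 := ZModModule.add_self c

lemma bd_cone (a : E) (c : Ch E) : bd (cone a c) = c + cone a (bd c) := by
  have : bd ∘ₗ cone a = LinearMap.id + cone a ∘ₗ bd := by
    apply ext1
    intro l
    simp [cone_single, bd_single, bdL]
  exact LinearMap.congr_fun this c

lemma bd_bdL (l : List E) : bd (bdL l) = 0 := by
  induction l with
  | nil => simp [bdL]
  | cons a l ih => 
    simp [bdL, bd_cone, bd_single, ih, add_self']

lemma bd_bd (c : Ch E) : bd (bd c) = 0 := by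
  have : bd ∘ₗ bd = (0 : Ch E →ₗ[ZMod 2] Ch E) := by
    apply ext1
    intro l
    simp [bd_single, bd_bdL]
  exact LinearMap.congr_fun this c

section geo
variable [NormedAddCommGroup E] [NormedSpace ℝ E]

noncomputable def bary (l : List E) : E := (l.length : ℝ)⁻¹ • l.sum

noncomputable def sd : ℕ → Ch E →ₗ[ZMod 2] Ch E
  | 0 => LinearMap.id
  | k + 1 => Finsupp.linearCombination (ZMod 2) (fun l => cone (bary l) (sd k (bdL l)))

lemma sd_single (k : ℕ) (l : List E) :
    sd (k+1) (Finsupp.single l 1) = cone (bary l) (sd k (bdL l)) := by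
  simp [sd, Finsupp.linearCombination_single]

lemma bd_sd (k : ℕ) (c : Ch E) : bd (sd (k+1) c) = sd k (bd c) := by
  induction k generalizing c with
  | zero =>
    have : bd ∘ₗ sd 1 = sd 0 ∘ₗ (bd : Ch E →ₗ[ZMod 2] Ch E) := by
      apply ext1
      intro l
      simp [sd_single, bd_single, bd_cone]
      simp [sd, bd_bdL]
    exact LinearMap.congr_fun this c
  | succ k ih =>
    have : bd ∘ₗ sd (k+2) = sd (k+1) ∘ₗ (bd : Ch E →ₗ[ZMod 2] Ch E) := by
      apply ext1
      intro l
      simp [sd_single, bd_single, bd_cone, ih, bd_bdL]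
    exact LinearMap.congr_fun this c

noncomputable def sg : Ch E →ₗ[ZMod 2] Ch E :=
  Finsupp.lmapDomain (ZMod 2) (ZMod 2) (List.map (fun x => -x))

lemma sg_single (l : List E) (r : ZMod 2) :
    sg (Finsupp.single l r) = Finsupp.single (l.map (fun x => -x)) r := by
  simp [sg, Finsupp.mapDomain_single]

lemma sg_cone (a : E) (c : Ch E) : sg (cone a c) = cone (-a) (sg c) := by
  have : sg ∘ₗ cone a = cone (-a) ∘ₗ sg := by
    apply ext1
    intro l
    simp [cone_single, sg_single]
  exact LinearMap.congr_fun this c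

lemma sg_bdL (l : List E) : sg (bdL l) = bdL (l.map (fun x => -x)) := by
  induction l with
  | nil => simp [bdL]
  | cons a l ih => simp [bdL, sg_cone, sg_single, ih]

lemma bary_neg (l : List E) : bary (l.map (fun x => -x)) = - bary l := by
  have : (l.map (fun x => -x)).sum = - l.sum := by
    induction l with
    | nil => simp
    | cons a l ih => simp only [List.map_cons, List.sum_cons, ih]; abel
  simp [bary, this]

lemma sg_sd (k : ℕ) (c : Ch E) : sg (sd k c) = sd k (sg c) := by
  induction k generalizing c with
  | zero => simp [sd]
  | succ k ih =>
    have : sg ∘ₗ sd (k+1) = sd (k+1) ∘ₗ (sg : Ch E →ₗ[ZMod 2] Ch E) := by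
      apply ext1
      intro l
      simp [sd_single, sg_single, sg_cone, ih, sg_bdL, bary_neg]
    exact LinearMap.congr_fun this c

lemma bd_sd_iter (k N : ℕ) (c : Ch E) : bd ((sd (k+1))^[N] c) = (sd k)^[N] (bd c) := by
  induction N generalizing c with
  | zero => simp
  | succ N ih => simp [ih, bd_sd]

lemma sg_sd_iter (k N : ℕ) (c : Ch E) : sg ((sd k)^[N] c) = (sd k)^[N] (sg c) := by
  induction N generalizing c with
  | zero => simp
  | succ N ih => simp [ih, sg_sd]

lemma sd_iter_add (k N : ℕ) (c d : Ch E) :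
    (sd k)^[N] (c + d) = (sd k)^[N] c + (sd k)^[N] d := by
  induction N generalizing c d with
  | zero => simp
  | succ N ih => simp [ih]

end geo

/-- cup product of the coboundaries of the given functions -/
def WL : List (E → ZMod 2) → List E → ZMod 2
  | [], [_] => 1
  | s :: fs, a :: b :: l => (s a + s b) * WL fs (b :: l)
  | _, _ => 0

def QL (s : E → ZMod 2) (fs : List (E → ZMod 2)) : List E → ZMod 2
  | [] => 0
  | a :: l => s a * WL fs (a :: l)

noncomputable def W (fs : List (E → ZMod 2)) : Ch E →ₗ[ZMod 2] ZMod 2 :=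
  Finsupp.linearCombination (ZMod 2) (WL fs)

noncomputable def Q (s : E → ZMod 2) (fs : List (E → ZMod 2)) : Ch E →ₗ[ZMod 2] ZMod 2 :=
  Finsupp.linearCombination (ZMod 2) (QL s fs)

lemma W_single (fs : List (E → ZMod 2)) (l : List E) :
    W fs (Finsupp.single l 1) = WL fs l := by simp [W, Finsupp.linearCombination_single]

lemma Q_single (s : E → ZMod 2) (fs : List (E → ZMod 2)) (l : List E) :
    Q s fs (Finsupp.single l 1) = QL s fs l := by simp [Q, Finsupp.linearCombination_single]

lemma WL_nil (fs : List (E → ZMod 2)) : WL fs [] = 0 := by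
  cases fs <;> simp [WL]

lemma W_cone2 (s : E → ZMod 2) (fs : List (E → ZMod 2)) (a b : E) (c : Ch E) :
    W (s :: fs) (cone a (cone b c)) = (s a + s b) * W fs (cone b c) := by
  have : W (s :: fs) ∘ₗ cone a ∘ₗ cone b = (s a + s b) • (W fs ∘ₗ cone b) := by
    apply ext1
    intro l
    simp [cone_single, W_single, WL]
  exact LinearMap.congr_fun this c

lemma W_nil_cone2 (a b : E) (c : Ch E) :
    W [] (cone a (cone b c)) = 0 := by
  have : W [] ∘ₗ cone a ∘ₗ cone b = 0 := by
    apply ext1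
    intro l
    simp [cone_single, W_single, WL]
  exact LinearMap.congr_fun this c

lemma Q_cone (s : E → ZMod 2) (fs : List (E → ZMod 2)) (a : E) (c : Ch E) :
    Q s fs (cone a c) = s a * W fs (cone a c) := by
  have : Q s fs ∘ₗ cone a = s a • (W fs ∘ₗ cone a) := by
    apply ext1
    intro l
    simp [cone_single, W_single, Q_single, QL]
  exact LinearMap.congr_fun this c

lemma zadd (x : ZMod 2) : x + x = 0 := CharTwo.add_self_eq_zero x

lemma W_bdL (fs : List (E → ZMod 2)) (l : List E) : W fs (bdL l) = 0 := by
  induction fs generalizing l with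
  | nil =>
    rcases l with _ | ⟨a, _ | ⟨b, l⟩⟩
    · simp [bdL]
    · simp [bdL, W_single, WL]
    · cases l <;> simp [bdL, W_single, WL, cone_single, W_nil_cone2, zadd]
  | cons s fs ih =>
    rcases l with _ | ⟨a, _ | ⟨b, _ | ⟨c, l⟩⟩⟩
    · simp [bdL]
    · simp [bdL, W_single, WL]
    · simp [bdL, W_single, WL, cone_single]
    · have h := ih (b :: c :: l)
      rw [bdL, map_add, W_single] at h
      rw [bdL, map_add, W_single, bdL, map_add, map_add, W_cone2, cone_single, W_single]
      simp only [WL]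
      have h2 : W fs (cone b (bdL (c :: l))) = WL fs (c :: l) := by
        have := zadd (WL fs (c :: l))
        linear_combination h - this
      rw [h2]
      have h3 := zadd ((s a + s b + s c) * WL fs (c :: l))
      linear_combination h3

lemma Q_bd (s : E → ZMod 2) (fs : List (E → ZMod 2)) (c : Ch E) :
    Q s fs (bd c) = W (s :: fs) c := by
  have : Q s fs ∘ₗ bd = W (s :: fs) := by
    apply ext1
    intro l
    simp only [LinearMap.comp_apply, bd_single, W_single]
    rcases l with _ | ⟨a, _ | ⟨b, l⟩⟩
    · simp [bdL, WL]
    · simp [bdL, WL, Q_single, QL]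
    · have h := W_bdL fs (a :: b :: l)
      rw [bdL, map_add, W_single] at h
      rw [bdL, map_add, Q_single, Q_cone]
      simp only [WL, QL]
      have := zadd (WL fs (b :: l))
      linear_combination (s a) * h - s a * this
  exact LinearMap.congr_fun this c

section geo2
variable [NormedAddCommGroup E] [NormedSpace ℝ E]

lemma WL_neg (S : Set E) (fs : List (E → ZMod 2)) (hfs : ∀ s ∈ fs, ∀ x ∈ S, s (-x) = s x + 1)
    (l : List E) (hl : ∀ x ∈ l, x ∈ S) : WL fs (l.map (fun x => -x)) = WL fs l := by
  induction fs generalizing l with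
  | nil => rcases l with _ | ⟨a, _ | ⟨b, l⟩⟩ <;> simp [WL]
  | cons s fs ih =>
    rcases l with _ | ⟨a, _ | ⟨b, l⟩⟩
    · simp [WL]
    · simp [WL]
    · have h := ih (fun s hs => hfs s (by simp [hs])) (b :: l) (fun x hx => hl x (by
        simp at hx ⊢; tauto))
      simp only [List.map_cons] at h ⊢
      simp only [WL, h, hfs s (by simp) a (hl a (by simp)), hfs s (by simp) b (hl b (by simp))]
      have := zadd (1 * WL fs (b :: l))
      linear_combination this

lemma Q_sg (S : Set E) (s : E → ZMod 2) (fs : List (E → ZMod 2))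
    (hs : ∀ x ∈ S, s (-x) = s x + 1)
    (hfs : ∀ s ∈ fs, ∀ x ∈ S, s (-x) = s x + 1)
    (c : Ch E) (hc : c ∈ Finsupp.supported (ZMod 2) (ZMod 2) {l : List E | ∀ x ∈ l, x ∈ S}) :
    Q s fs (c + sg c) = W fs c := by
  rw [Finsupp.supported_eq_span_single] at hc
  induction hc using Submodule.span_induction with
  | mem x h =>
    obtain ⟨l, hl, rfl⟩ := h
    rw [map_add, sg_single, Q_single, Q_single, W_single]
    rcases l with _ | ⟨a, l⟩
    · simp [QL, WL_nil]
    · have h := WL_neg S fs hfs (a :: l) hl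
      simp only [List.map_cons] at h ⊢
      simp only [QL, h, hs a (hl a (by simp))]
      have := zadd (s a * WL fs (a :: l))
      linear_combination this
  | zero => simp
  | add x y _ _ hx hy => 
    rw [map_add] at hx hy
    simp only [map_add]
    rw [← hx, ← hy]; ring
  | smul r x _ hx => 
    rw [map_add] at hx
    simp only [map_smul, map_add]
    rw [← hx]; simp [mul_add]

/-- octahedral sphere -/
noncomputable def oct {V : Type*} (e : V → E) : List V → Ch E
  | [] => Finsupp.single [] 1
  | a :: L => cone (e a) (oct e L) + cone (-(e a)) (oct e L)

lemma bd_oct {V : Type*} (e : V → E) (L : List V) : bd (oct e L) = 0 := by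
  induction L with
  | nil => simp [oct, bd_single, bdL]
  | cons a L ih => simp [oct, bd_cone, ih, add_self']

lemma sg_oct {V : Type*} (e : V → E) (L : List V) : sg (oct e L) = oct e L := by
  induction L with
  | nil => simp [oct, sg_single]
  | cons a L ih => simp [oct, sg_cone, ih, add_comm]

lemma main_alg {V : Type*} (e : V → E) (S : Set E) (N : ℕ) (fs : List (E → ZMod 2))
    (hfs : ∀ s ∈ fs, ∀ x ∈ S, s (-x) = s x + 1)
    (a : V) (L : List V) (hL : L.length = fs.length) (hnd : (a :: L).Nodup)
    (hS : ∀ (a : V) (L : List V), (a :: L).Nodup → (sd (L.length + 1))^[N] (cone (e a) (oct e L)) ∈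
      Finsupp.supported (ZMod 2) (ZMod 2) {l : List E | ∀ x ∈ l, x ∈ S}) :
    W fs ((sd (L.length + 1))^[N] (cone (e a) (oct e L))) = 1 := by
  induction fs generalizing a L with
  | nil =>
    have : L = [] := by simpa using hL
    subst this
    have h1 : sd (0+1) (Finsupp.single [e a] 1) = Finsupp.single [e a] 1 := by
      rw [sd_single]
      simp [bary, bdL, sd, cone_single]
    have h2 : (sd (0+1))^[N] (Finsupp.single [e a] 1) = Finsupp.single [e a] 1 :=
      Function.iterate_fixed h1 N
    simp only [oct, cone_single, List.length_nil]
    rw [h2, W_single]; rfl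
  | cons s fs ih =>
    rcases L with _ | ⟨b, L⟩
    · simp at hL
    · rw [← Q_bd, bd_sd_iter, bd_cone, bd_oct, map_zero, add_zero]
      have : oct e (b :: L) = cone (e b) (oct e L) + sg (cone (e b) (oct e L)) := by
        rw [sg_cone, sg_oct, oct]
      rw [this, sd_iter_add, ← sg_sd_iter, List.length_cons,
        Q_sg S s fs (hfs s (by simp)) (fun s hs => hfs s (by simp [hs])) _ (hS b L (List.Nodup.of_cons hnd))]
      exact ih (fun s hs => hfs s (by simp [hs])) b L (by simpa using hL) (List.Nodup.of_cons hnd)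

end geo2

section geo3
variable [NormedAddCommGroup E] [NormedSpace ℝ E]

lemma supported_map {A B : Set (List E)} (f : Ch E →ₗ[ZMod 2] Ch E)
    (h : ∀ l ∈ A, f (Finsupp.single l 1) ∈ Finsupp.supported (ZMod 2) (ZMod 2) B)
    (c : Ch E) (hc : c ∈ Finsupp.supported (ZMod 2) (ZMod 2) A) :
    f c ∈ Finsupp.supported (ZMod 2) (ZMod 2) B := by
  rw [Finsupp.supported_eq_span_single] at hc
  have : Submodule.span (ZMod 2) ((fun i => Finsupp.single i (1 : ZMod 2)) '' A) ≤
      (Finsupp.supported (ZMod 2) (ZMod 2) B).comap f := by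
    rw [Submodule.span_le]
    rintro _ ⟨l, hl, rfl⟩
    exact h l hl
  exact this hc

lemma bdL_supp (l : List E) : bdL l ∈ Finsupp.supported (ZMod 2) (ZMod 2)
    {t : List E | t.length + 1 = l.length ∧ ∀ x ∈ t, x ∈ l} := by
  induction l with
  | nil => simp [bdL]
  | cons a l ih =>
    rw [bdL]
    apply Submodule.add_mem
    · apply Finsupp.single_mem_supported
      simp only [Set.mem_setOf_eq, List.length_cons, true_and]
      intro x hx; simp [hx]
    · refine supported_map (cone a) ?_ _ ih
      rintro t ⟨h1, h2⟩
      rw [cone_single]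
      apply Finsupp.single_mem_supported
      simp only [Set.mem_setOf_eq, List.length_cons, h1, true_and]
      intro x hx
      simp only [List.mem_cons] at hx ⊢
      rcases hx with h | h
      · exact Or.inl h
      · exact Or.inr (h2 x h)

lemma bary_mem (l : List E) (hl : l ≠ []) (K : Set E) (hK : Convex ℝ K) (h : ∀ x ∈ l, x ∈ K) :
    bary l ∈ K := by
  have hpos : (0:ℝ) < l.length := by
    exact_mod_cast List.length_pos_iff.mpr hl
  have : bary l = ∑ i : Fin l.length, (l.length : ℝ)⁻¹ • l.get i := by
    rw [← Finset.smul_sum, bary]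
    congr 1
    rw [Fin.sum_univ_def]
    simp
  rw [this]
  apply hK.sum_mem
  · intro i _; positivity
  · simp [hpos.ne']
  · intro i _; exact h _ (List.get_mem l i)

lemma sum_sub_bound (l : List E) (v : E) (D : ℝ) (h : ∀ y ∈ l, dist y v ≤ D) :
    ‖l.sum - (l.length : ℝ) • v‖ ≤ l.length * D := by
  induction l with
  | nil => simp
  | cons a l ih =>
    have h1 := ih (fun y hy => h y (by simp [hy]))
    have h2 := h a (by simp)
    rw [dist_eq_norm] at h2
    have : (a :: l).sum - ((a :: l).length : ℝ) • v = (a - v) + (l.sum - (l.length : ℝ) • v) := by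
      simp only [List.sum_cons, List.length_cons, Nat.cast_add, Nat.cast_one, add_smul, one_smul]
      abel
    rw [this]
    refine (norm_add_le _ _).trans ?_
    simp only [List.length_cons, Nat.cast_add, Nat.cast_one]
    linarith

lemma bary_dist (l : List E) (D : ℝ) (h : ∀ x ∈ l, ∀ y ∈ l, dist x y ≤ D) (v : E) (hv : v ∈ l) :
    dist v (bary l) ≤ (1 - (l.length : ℝ)⁻¹) * D := by
  obtain ⟨s, t, rfl⟩ := List.append_of_mem hv
  have h1 := sum_sub_bound (s ++ t) v D (fun y hy => h y (by
    simp only [List.mem_append, List.mem_cons] at hy ⊢; tauto) v hv)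
  set m : ℝ := ((s ++ t).length : ℝ) with hm
  have hm0 : 0 ≤ m := by positivity
  have hlen : ((s ++ v :: t).length : ℝ) = m + 1 := by
    simp [hm]; ring
  have hb : bary (s ++ v :: t) - v = (m+1)⁻¹ • ((s ++ t).sum - m • v) := by
    rw [bary, hlen, smul_sub, smul_smul]
    have : (s ++ v :: t).sum = (s ++ t).sum + v := by
      simp only [List.sum_append, List.sum_cons]; abel
    rw [this, smul_add]
    have h3 : ((m+1)⁻¹ * m) = 1 - (m+1)⁻¹ := by field_simp; ring
    rw [h3, sub_smul, one_smul]; abel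
  rw [dist_comm, dist_eq_norm, hb, norm_smul, hlen, Real.norm_of_nonneg (by positivity)]
  calc (m+1)⁻¹ * ‖(s ++ t).sum - m • v‖ ≤ (m+1)⁻¹ * (m * D) := by gcongr
    _ = _ := by field_simp; ring

lemma sd_supp (M : ℕ) (D : ℝ) (hD : 0 ≤ D) (k : ℕ) (hk : k ≤ M) (l : List E) (hl : l.length = k)
    (K : Set E) (hK : Convex ℝ K) (hlK : ∀ x ∈ l, x ∈ K)
    (h : ∀ x ∈ l, ∀ y ∈ l, dist x y ≤ D) :
    sd k (Finsupp.single l 1) ∈ Finsupp.supported (ZMod 2) (ZMod 2)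
      {t : List E | t.length = k ∧ (∀ x ∈ t, x ∈ K) ∧
        ∀ x ∈ t, ∀ y ∈ t, dist x y ≤ (1 - (M : ℝ)⁻¹) * D} := by
  induction k generalizing l K with
  | zero =>
    have : l = [] := List.length_eq_zero_iff.mp hl
    subst this
    apply Finsupp.single_mem_supported
    simp
  | succ k ih =>
    have hne : l ≠ [] := by rintro rfl; simp at hl
    have hr : (1 - (l.length : ℝ)⁻¹) * D ≤ (1 - (M : ℝ)⁻¹) * D := by
      rw [hl]; gcongr
    have hr0 : 0 ≤ (1 - (M : ℝ)⁻¹) * D := by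
      apply mul_nonneg _ hD
      have : ((M : ℝ))⁻¹ ≤ 1 := by
        apply inv_le_one_of_one_le₀
        have : 1 ≤ M := by omega
        exact_mod_cast this
      linarith
    set K' : Set E := K ∩ Metric.closedBall (bary l) ((1 - (M : ℝ)⁻¹) * D) with hK'
    have hK'c : Convex ℝ K' := hK.inter (convex_closedBall _ _)
    have hlK' : ∀ x ∈ l, x ∈ K' := fun x hx =>
      ⟨hlK x hx, (bary_dist l D h x hx).trans hr⟩
    rw [sd_single]
    have h1 : sd k (bdL l) ∈ Finsupp.supported (ZMod 2) (ZMod 2)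
      {t : List E | t.length = k ∧ (∀ x ∈ t, x ∈ K') ∧
        ∀ x ∈ t, ∀ y ∈ t, dist x y ≤ (1 - (M : ℝ)⁻¹) * D} := by
      refine supported_map (sd k) ?_ _ (bdL_supp l)
      rintro t ⟨ht1, ht2⟩
      exact ih (by omega) t (by omega) K' hK'c (fun x hx => hlK' x (ht2 x hx))
        (fun x hx y hy => h x (ht2 x hx) y (ht2 y hy))
    refine supported_map (cone (bary l)) ?_ _ h1
    rintro t ⟨ht1, ht2, ht3⟩
    rw [cone_single]
    apply Finsupp.single_mem_supported
    refine ⟨by simp [ht1], ?_, ?_⟩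
    · intro x hx
      rcases List.mem_cons.mp hx with rfl | hx
      · exact bary_mem l hne K hK hlK
      · exact (ht2 x hx).1
    · intro x hx y hy
      rcases List.mem_cons.mp hx with rfl | hx <;> rcases List.mem_cons.mp hy with rfl | hy
      · simpa using hr0
      · rw [dist_comm]; exact (ht2 y hy).2
      · exact (ht2 x hx).2
      · exact ht3 x hx y hy

lemma sd_iter_supp (M : ℕ) (hM : 1 ≤ M) (𝒦 : Set (Set E)) (h𝒦 : ∀ K ∈ 𝒦, Convex ℝ K)
    (D : ℝ) (hD : 0 ≤ D) (k : ℕ) (hk : k ≤ M) (N : ℕ) (c : Ch E)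
    (hc : c ∈ Finsupp.supported (ZMod 2) (ZMod 2)
      {t : List E | t.length = k ∧ (∃ K ∈ 𝒦, ∀ x ∈ t, x ∈ K) ∧
        ∀ x ∈ t, ∀ y ∈ t, dist x y ≤ D}) :
    (sd k)^[N] c ∈ Finsupp.supported (ZMod 2) (ZMod 2)
      {t : List E | t.length = k ∧ (∃ K ∈ 𝒦, ∀ x ∈ t, x ∈ K) ∧
        ∀ x ∈ t, ∀ y ∈ t, dist x y ≤ (1 - (M : ℝ)⁻¹)^N * D} := by
  induction N with
  | zero => simpa using hc
  | succ N ih =>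
    rw [Function.iterate_succ_apply']
    refine supported_map (sd k) ?_ _ ih
    rintro t ⟨h1, ⟨K, hK, h2⟩, h3⟩
    have hr0 : 0 ≤ (1 - (M : ℝ)⁻¹) := by
      have : ((M : ℝ))⁻¹ ≤ 1 := by
        apply inv_le_one_of_one_le₀
        exact_mod_cast hM
      linarith
    have := sd_supp M ((1 - (M : ℝ)⁻¹)^N * D) (by positivity) k hk t h1 K (h𝒦 K hK) h2 h3
    refine Finsupp.supported_mono ?_ this
    rintro t' ⟨a1, a2, a3⟩
    refine ⟨a1, ⟨K, hK, a2⟩, fun x hx y hy => (a3 x hx y hy).trans (le_of_eq ?_)⟩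
    rw [pow_succ]; ring

end geo3

section oct
variable {V : Type*} [Fintype V] [DecidableEq V]

/-- closed faces of the octahedral sphere -/
def face (ε : V → ℝ) : Set (V → ℝ) := {x | (∀ v, 0 ≤ ε v * x v) ∧ ∑ v, ε v * x v = 1}

def l1sphere (V : Type*) [Fintype V] : Set (V → ℝ) := {x | ∑ v, |x v| = 1}

lemma face_convex (ε : V → ℝ) : Convex ℝ (face ε) := by
  rintro x ⟨hx1, hx2⟩ y ⟨hy1, hy2⟩ a b ha hb hab
  have key : ∀ v, ε v * (a • x + b • y) v = a * (ε v * x v) + b * (ε v * y v) := by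
    intro v; simp only [Pi.add_apply, Pi.smul_apply, smul_eq_mul]; ring
  constructor
  · intro v
    rw [key]
    have := hx1 v
    have := hy1 v
    positivity
  · simp only [key, Finset.sum_add_distrib, ← Finset.mul_sum, hx2, hy2]
    linarith

lemma face_sub (ε : V → ℝ) (hε : ∀ v, |ε v| = 1) : face ε ⊆ l1sphere V := by
  rintro x ⟨h1, h2⟩
  show ∑ v, |x v| = 1
  rw [← h2]
  apply Finset.sum_congr rfl
  intro v _
  rw [← abs_of_nonneg (h1 v), abs_mul, hε, one_mul]

lemma oct_supp (L : List V) (hL : L.Nodup) :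
    oct (fun v => (Pi.single v 1 : V → ℝ)) L ∈ Finsupp.supported (ZMod 2) (ZMod 2)
      {t : List (V → ℝ) | t.length = L.length ∧ ∃ ε : V → ℝ, (∀ v, |ε v| = 1) ∧
        ∀ x ∈ t, x ∈ face ε ∧ ∀ v, v ∉ L → x v = 0} := by
  induction L with
  | nil =>
    apply Finsupp.single_mem_supported
    exact ⟨rfl, fun _ => 1, by simp, by simp⟩
  | cons a L ih =>
    have haL : a ∉ L := (List.nodup_cons.mp hL).1
    have key : ∀ s : ℝ, |s| = 1 → 
      cone (s • (Pi.single a 1 : V → ℝ)) (oct (fun v => (Pi.single v 1 : V → ℝ)) L) ∈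
      Finsupp.supported (ZMod 2) (ZMod 2)
      {t : List (V → ℝ) | t.length = (a :: L).length ∧ ∃ ε : V → ℝ, (∀ v, |ε v| = 1) ∧
        ∀ x ∈ t, x ∈ face ε ∧ ∀ v, v ∉ a :: L → x v = 0} := by
      intro s hs
      refine supported_map (cone _) ?_ _ (ih (List.nodup_cons.mp hL).2)
      rintro t ⟨h1, ε, h2, h3⟩
      rw [cone_single]
      apply Finsupp.single_mem_supported
      refine ⟨by simp [h1], Function.update ε a s, ?_, ?_⟩
      · intro v
        by_cases hv : v = a
        · subst hv; simpa using hs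
        · simpa [hv] using h2 v
      · have hss : s * s = 1 := by rw [← abs_mul_abs_self, hs]; norm_num
        intro x hx
        rcases List.mem_cons.mp hx with rfl | hx
        · have e1 : ∀ v, Function.update ε a s v * (s • (Pi.single a 1 : V → ℝ)) v = 
              if v = a then 1 else 0 := by
            intro v
            by_cases hv : v = a
            · subst hv; simp [hss]
            · simp [hv]
          refine ⟨⟨?_, ?_⟩, ?_⟩
          · intro v; rw [e1]; split_ifs <;> norm_num
          · simp only [e1]; simp
          · intro v hv
            have : v ≠ a := by rintro rfl; simp at hv
            simp [this]
        · obtain ⟨⟨f1, f2⟩, f3⟩ := h3 x hx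
          have e1 : ∀ v, Function.update ε a s v * x v = ε v * x v := by
            intro v
            by_cases hv : v = a
            · subst hv; simp [f3 v haL]
            · simp [hv]
          refine ⟨⟨?_, ?_⟩, ?_⟩
          · intro v; rw [e1]; exact f1 v
          · simp only [e1, f2]
          · intro v hv
            exact f3 v (fun h => hv (by simp [h]))
    rw [oct]
    apply Submodule.add_mem
    · simpa using key 1 (by simp)
    · simpa using key (-1) (by simp)

lemma l1_norm_le {x : V → ℝ} (hx : x ∈ l1sphere V) : ‖x‖ ≤ 1 := by
  rw [pi_norm_le_iff_of_nonneg (by norm_num)]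
  intro v
  have : ∑ v, |x v| = 1 := hx
  rw [← this, Real.norm_eq_abs]
  exact Finset.single_le_sum (f := fun v => |x v|) (fun _ _ => abs_nonneg _) (Finset.mem_univ v)

lemma l1_compact : IsCompact (l1sphere V) := by
  apply Metric.isCompact_of_isClosed_isBounded
  · have : Continuous (fun x : V → ℝ => ∑ v, |x v|) := by fun_prop
    exact isClosed_eq this continuous_const
  · apply (Metric.isBounded_closedBall (x := (0 : V → ℝ)) (r := 1)).subset
    intro x hx
    simpa using l1_norm_le hx

lemma l1_neg {x : V → ℝ} (hx : x ∈ l1sphere V) : -x ∈ l1sphere V := by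
  have : ∑ v, |x v| = 1 := hx
  simpa [l1sphere] using this

lemma l1_ne {x : V → ℝ} (hx : x ∈ l1sphere V) : x ≠ 0 := by
  rintro rfl
  simp [l1sphere] at hx

lemma H_supp (M : ℕ) (hM : M = Fintype.card V) (N : ℕ) (a : V) (L : List V) (hL : (a :: L).Nodup) :
    (sd (L.length + 1))^[N] (cone (Pi.single a 1 : V → ℝ)
      (oct (fun v => (Pi.single v 1 : V → ℝ)) L)) ∈ Finsupp.supported (ZMod 2) (ZMod 2)
      {t : List (V → ℝ) | t.length = L.length + 1 ∧ (∀ x ∈ t, x ∈ l1sphere V) ∧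
        ∀ x ∈ t, ∀ y ∈ t, dist x y ≤ (1 - (M : ℝ)⁻¹)^N * 2} := by
  have hlen : (a :: L).length ≤ M := by rw [hM]; exact hL.length_le_card
  rw [List.length_cons] at hlen
  have h0 : cone (Pi.single a 1 : V → ℝ)
      (oct (fun v => (Pi.single v 1 : V → ℝ)) L) ∈ Finsupp.supported (ZMod 2) (ZMod 2)
      {t : List (V → ℝ) | t.length = L.length + 1 ∧
        (∃ K ∈ {K : Set (V → ℝ) | ∃ ε : V → ℝ, (∀ v, |ε v| = 1) ∧ K = face ε}, ∀ x ∈ t, x ∈ K) ∧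
        ∀ x ∈ t, ∀ y ∈ t, dist x y ≤ 2} := by
    have haL : a ∉ L := (List.nodup_cons.mp hL).1
    refine supported_map (cone _) ?_ _ (oct_supp L (List.nodup_cons.mp hL).2)
    rintro t ⟨h1, ε, h2, h3⟩
    rw [cone_single]
    apply Finsupp.single_mem_supported
    have hε' : ∀ v, |Function.update ε a 1 v| = 1 := by
      intro v
      by_cases hv : v = a
      · subst hv; simp
      · simpa [hv] using h2 v
    have hmem : ∀ x ∈ (Pi.single a 1 : V → ℝ) :: t, x ∈ face (Function.update ε a 1) := by
      intro x hx
      rcases List.mem_cons.mp hx with rfl | hx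
      · have e1 : ∀ v, Function.update ε a 1 v * (Pi.single a 1 : V → ℝ) v = 
              if v = a then 1 else 0 := by
          intro v
          by_cases hv : v = a
          · subst hv; simp
          · simp [hv]
        refine ⟨?_, ?_⟩
        · intro v; rw [e1]; split_ifs <;> norm_num
        · simp only [e1]; simp
      · obtain ⟨⟨f1, f2⟩, f3⟩ := h3 x hx
        have e1 : ∀ v, Function.update ε a 1 v * x v = ε v * x v := by
          intro v
          by_cases hv : v = a
          · subst hv; simp [f3 v haL]
          · simp [hv]
        exact ⟨fun v => by rw [e1]; exact f1 v, by simp only [e1, f2]⟩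
    refine ⟨by simp [h1], ⟨_, ⟨_, hε', rfl⟩, hmem⟩, ?_⟩
    intro x hx y hy
    have a1 := l1_norm_le (face_sub _ hε' (hmem x hx))
    have a2 := l1_norm_le (face_sub _ hε' (hmem y hy))
    rw [dist_eq_norm]
    refine (norm_sub_le _ _).trans (by linarith)
  have h1 := sd_iter_supp M (by omega) _ (by rintro K ⟨ε, -, rfl⟩; exact face_convex ε)
    2 (by norm_num) (L.length + 1) hlen N _ h0
  refine Finsupp.supported_mono ?_ h1
  rintro t ⟨b1, ⟨K, ⟨ε, hε, rfl⟩, b2⟩, b3⟩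
  exact ⟨b1, fun x hx => face_sub ε hε (b2 x hx), b3⟩

open Classical in
noncomputable def sgn {E : Type*} [Neg E] (g : E → ℝ) (x : E) : ZMod 2 :=
  if 0 < g x ∨ (g x = 0 ∧ WellOrderingRel x (-x)) then 1 else 0

lemma sgn_neg (g : (V → ℝ) → ℝ) (x : V → ℝ) (hx : x ≠ 0) (hg : g (-x) = - g x) :
    sgn g (-x) = sgn g x + 1 := by
  have hne : x ≠ -x := by
    intro h
    apply hx
    funext v
    have := congrFun h v
    simp only [Pi.neg_apply, Pi.zero_apply] at this ⊢
    linarith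
  have two : (1 : ZMod 2) + 1 = 0 := rfl
  rcases lt_trichotomy (g x) 0 with h | h | h
  · have e1 : sgn g (-x) = 1 := if_pos (Or.inl (by rw [hg]; linarith))
    have e2 : sgn g x = 0 := if_neg (by rintro (h' | ⟨h', -⟩) <;> linarith)
    rw [e1, e2, zero_add]
  · rcases trichotomous_of WellOrderingRel x (-x) with h1 | h1 | h1
    · have h2 : ¬ WellOrderingRel (-x) x := asymm h1
      have e1 : sgn g x = 1 := if_pos (Or.inr ⟨h, h1⟩)
      have e2 : sgn g (-x) = 0 := if_neg (by
        rw [hg, neg_neg, h]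
        rintro (h' | ⟨-, h'⟩)
        · simp at h'
        · exact h2 h')
      rw [e1, e2, two]
    · exact absurd h1 hne
    · have h2 : ¬ WellOrderingRel x (-x) := asymm h1
      have e1 : sgn g (-x) = 1 := if_pos (Or.inr ⟨by rw [hg, h, neg_zero], by rwa [neg_neg]⟩)
      have e2 : sgn g x = 0 := if_neg (by
        rw [h]
        rintro (h' | ⟨-, h'⟩)
        · simp at h'
        · exact h2 h')
      rw [e1, e2, zero_add]
  · have e1 : sgn g x = 1 := if_pos (Or.inl h)
    have e2 : sgn g (-x) = 0 := if_neg (by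
      rw [hg]
      rintro (h' | ⟨h', -⟩) <;> linarith)
    rw [e1, e2, two]

lemma sgn_eq {E : Type*} [Neg E] (g : E → ℝ) (x y z : E) (δ : ℝ) (hx : δ ≤ |g x|)
    (hy : |g y - g x| < δ) (hz : |g z - g x| < δ) : sgn g y = sgn g z := by
  rw [abs_lt] at hy hz
  unfold sgn
  rcases le_abs.mp hx with h | h
  · rw [if_pos (Or.inl (by linarith)), if_pos (Or.inl (by linarith))]
  · rw [if_neg, if_neg]
    · rintro (h' | ⟨h', -⟩) <;> linarith
    · rintro (h' | ⟨h', -⟩) <;> linarith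

lemma WL_zero {E : Type*} (fs : List (E → ZMod 2)) (t : List E) (s : E → ZMod 2) (hs : s ∈ fs)
    (h : ∀ x ∈ t, ∀ y ∈ t, s x = s y) : WL fs t = 0 := by
  induction fs generalizing t with
  | nil => simp at hs
  | cons s' fs ih =>
    rcases t with _ | ⟨a, _ | ⟨b, t⟩⟩
    · simp [WL]
    · simp [WL]
    · simp only [WL]
      rcases List.mem_cons.mp hs with rfl | hs
      · rw [h a (by simp) b (by simp), zadd, zero_mul]
      · rw [ih (b :: t) hs, mul_zero]
        intro x hx y hy
        exact h x (List.mem_cons_of_mem _ hx) y (List.mem_cons_of_mem _ hy)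

theorem borsuk_ulam (m : ℕ) (hm : m + 1 = Fintype.card V) (F : (V → ℝ) → (Fin m → ℝ))
    (hc : ContinuousOn F (l1sphere V)) (hodd : ∀ x ∈ l1sphere V, F (-x) = - F x)
    (hne : ∀ x ∈ l1sphere V, F x ≠ 0) : False := by
  obtain ⟨δ, hδ, hδF⟩ : ∃ δ > 0, ∀ x ∈ l1sphere V, δ ≤ ‖F x‖ := by
    rcases (l1sphere V).eq_empty_or_nonempty with h | h
    · exact ⟨1, one_pos, by simp [h]⟩
    · obtain ⟨x, hx, hmin⟩ := l1_compact.exists_isMinOn h hc.norm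
      exact ⟨‖F x‖, norm_pos_iff.mpr (hne x hx), fun y hy => hmin hy⟩
  have huc := l1_compact.uniformContinuousOn_of_continuous hc
  rw [Metric.uniformContinuousOn_iff] at huc
  obtain ⟨η, hη, hηF⟩ := huc δ hδ
  have hr0 : 0 ≤ 1 - (Fintype.card V : ℝ)⁻¹ := by
    have : ((Fintype.card V : ℝ))⁻¹ ≤ 1 := by
      apply inv_le_one_of_one_le₀
      rw [← hm]; push_cast; linarith [(Nat.cast_nonneg m : (0:ℝ) ≤ m)]
    linarith
  have hr1 : 1 - (Fintype.card V : ℝ)⁻¹ < 1 := by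
    have : 0 < ((Fintype.card V : ℝ))⁻¹ := by
      rw [← hm]; positivity
    linarith
  obtain ⟨N, hN⟩ := exists_pow_lt_of_lt_one (show 0 < η / 2 by linarith) hr1
  obtain ⟨a, L, haL⟩ : ∃ a L, (Finset.univ : Finset V).toList = a :: L := by
    apply List.exists_cons_of_length_pos
    rw [Finset.length_toList, Finset.card_univ]; omega
  have hnd : (a :: L).Nodup := haL ▸ Finset.nodup_toList _
  have hlen : L.length = m := by
    have := congrArg List.length haL
    rw [Finset.length_toList, Finset.card_univ, List.length_cons] at this
    omega
  set fs : List ((V → ℝ) → ZMod 2) := (List.finRange m).map (fun i => sgn (fun x => F x i)) with hfs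
  have h1 := main_alg (fun v => (Pi.single v 1 : V → ℝ)) (l1sphere V) N fs (by
      intro s hs x hx
      rw [hfs, List.mem_map] at hs
      obtain ⟨i, -, rfl⟩ := hs
      apply sgn_neg _ _ (l1_ne hx)
      simp [hodd x hx]) a L (by simp [hfs, hlen]) hnd (by
      intro a L hL
      refine Finsupp.supported_mono ?_ (H_supp _ rfl N a L hL)
      rintro t ⟨-, h, -⟩
      exact h)
  have h2 := H_supp _ rfl N a L hnd
  have h3 : ∀ c ∈ Finsupp.supported (ZMod 2) (ZMod 2)
      {t : List (V → ℝ) | t.length = L.length + 1 ∧ (∀ x ∈ t, x ∈ l1sphere V) ∧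
        ∀ x ∈ t, ∀ y ∈ t, dist x y ≤ (1 - (Fintype.card V : ℝ)⁻¹)^N * 2}, W fs c = 0 := by
    intro c hc
    rw [Finsupp.supported_eq_span_single] at hc
    have hle : Submodule.span (ZMod 2) ((fun i => Finsupp.single i (1 : ZMod 2)) ''
      {t : List (V → ℝ) | t.length = L.length + 1 ∧ (∀ x ∈ t, x ∈ l1sphere V) ∧
        ∀ x ∈ t, ∀ y ∈ t, dist x y ≤ (1 - (Fintype.card V : ℝ)⁻¹)^N * 2}) ≤
        LinearMap.ker (W fs) := by
      rw [Submodule.span_le]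
      rintro _ ⟨t, ⟨t1, t2, t3⟩, rfl⟩
      show W fs _ = 0
      rw [W_single]
      obtain ⟨x, t', rfl⟩ := List.exists_cons_of_length_pos (show 0 < t.length by omega)
      have hx := hδF x (t2 x (by simp))
      obtain ⟨i, hi⟩ : ∃ i, δ ≤ |F x i| := by
        by_contra! hcon
        have := (pi_norm_lt_iff hδ).mpr (fun i => by rw [Real.norm_eq_abs]; exact hcon i)
        linarith
      have hclose : ∀ y ∈ x :: t', |F y i - F x i| < δ := by
        intro y hy
        have hd : dist y x < η := lt_of_le_of_lt (t3 y hy x (by simp)) (by linarith)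
        have := hηF y (t2 y hy) x (t2 x (by simp)) hd
        exact lt_of_le_of_lt (dist_le_pi_dist (F y) (F x) i) this
      apply WL_zero fs _ (sgn (fun x => F x i))
      · rw [hfs, List.mem_map]
        exact ⟨i, List.mem_finRange i, rfl⟩
      · intro y hy z hz
        exact sgn_eq (fun x => F x i) x y z δ hi (hclose y hy) (hclose z hz)
    exact hle hc
  rw [h3 _ h2] at h1
  exact zero_ne_one h1

end oct

end BU

section final

lemma genus_l1 {V : Type*} [Fintype V] [DecidableEq V] (hV : 1 ≤ Fintype.card V) :
    Fintype.card V ≤ genus (BU.l1sphere V) := by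
  classical
  unfold genus
  apply le_csInf
  · refine ⟨Fintype.card V, fun x i => x.1 ((Fintype.equivFin V).symm i), ?_, ?_, ?_⟩
    · exact continuous_pi fun i => (continuous_apply _).comp continuous_subtype_val
    · intro x h
      apply BU.l1_ne x.2
      funext v
      have := congrFun h (Fintype.equivFin V v)
      simpa using this
    · intro x hx hx'
      funext i
      simp
  · rintro m ⟨f, hf, hne, hodd⟩
    by_contra! hlt
    obtain ⟨m', hm'⟩ : ∃ m', m' + 1 = Fintype.card V := ⟨Fintype.card V - 1, by omega⟩
    let g : BU.l1sphere V → (Fin m' → ℝ) := fun x i => if h : i.1 < m then f x ⟨i.1, h⟩ else 0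
    have hg : Continuous g := by
      apply continuous_pi
      intro i
      by_cases h : i.1 < m
      · simp only [g, h, dif_pos]; fun_prop
      · simp only [g, h, dif_neg, not_false_eq_true]; fun_prop
    have hgm : ∀ x, g x ≠ 0 := by
      intro x h
      apply hne x
      funext j
      have := congrFun h ⟨j.1, by omega⟩
      simpa [g] using this
    let F : (V → ℝ) → (Fin m' → ℝ) := fun x => if h : x ∈ BU.l1sphere V then g ⟨x, h⟩ else 0
    have hFr : (BU.l1sphere V).domRestrict F = g := by
      funext x
      simp [F]
    refine BU.borsuk_ulam m' hm' F ?_ ?_ ?_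
    · rw [continuousOn_iff_continuous_domRestrict, hFr]; exact hg
    · intro x hx
      have hx' := BU.l1_neg hx
      simp only [F, hx, hx', dif_pos]
      funext i
      simp only [g, Pi.neg_apply, hodd x hx hx']
      split_ifs <;> simp
    · intro x hx
      simp only [F, hx, dif_pos]
      exact hgm _

lemma genus_meets {V : Type*} [Fintype V] (S : Set (V → ℝ)) (k : ℕ) (hk : 1 ≤ k)
    (hS : k ≤ genus S) (U : Submodule ℝ (V → ℝ))
    (hU : Fintype.card V + 1 ≤ Module.finrank ℝ U + k) : ∃ x ∈ S, x ∈ U := by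
  by_contra! hcon
  have hq := U.finrank_quotient_add_finrank
  rw [Module.finrank_fintype_fun_eq_card] at hq
  set d := Module.finrank ℝ ((V → ℝ) ⧸ U) with hd
  let ψ : ((V → ℝ) ⧸ U) ≃ₗ[ℝ] (Fin d → ℝ) := LinearEquiv.ofFinrankEq _ _ (by simp [hd])
  let π : (V → ℝ) →ₗ[ℝ] (Fin d → ℝ) := ψ.toLinearMap ∘ₗ U.mkQ
  have hπ : Continuous π := π.continuous_of_finiteDimensional
  have : genus S ≤ d := by
    apply Nat.sInf_le
    refine ⟨fun x => π x.1, hπ.comp continuous_subtype_val, ?_, ?_⟩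
    · intro x h
      apply hcon x.1 x.2
      have : U.mkQ x.1 = 0 := by simpa [π] using h
      simpa using this
    · intro x hx hx'
      simp
  omega

lemma genus_zero {V : Type*} [Fintype V] (S : Set (V → ℝ)) (h : (0 : V → ℝ) ∈ S) :
    genus S = 0 := by
  unfold genus
  rw [Nat.sInf_eq_zero]
  right
  rw [Set.eq_empty_iff_forall_notMem]
  rintro m ⟨f, -, hne, hodd⟩
  apply hne ⟨0, h⟩
  have h' : -(0 : V → ℝ) ∈ S := by simpa using h
  have e := hodd 0 h h'
  have e2 : (⟨-0, h'⟩ : S) = ⟨0, h⟩ := by simp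
  rw [e2] at e
  funext i
  have := congrFun e i
  simp only [Pi.neg_apply, Pi.zero_apply] at this ⊢
  linarith

section sel
variable {V : Type*} [Fintype V] [DecidableEq V] (G : SimpleGraph V) [DecidableRel G.Adj]
    (μ : V → ℝ) (w : Sym2 V → ℝ)

noncomputable def aw (u v : V) : ℝ := if G.Adj u v then w s(u, v) else 0

noncomputable def TV (x : V → ℝ) : ℝ := ∑ u, ∑ v, aw G w u v * |x u - x v|

lemma aw_symm (u v : V) : aw G w u v = aw G w v u := by
  unfold aw
  simp only [G.adj_comm u v, Sym2.eq_swap (a := u) (b := v)]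

lemma aw_nonneg (hw : ∀ e ∈ G.edgeSet, 0 < w e) (u v : V) : 0 ≤ aw G w u v := by
  unfold aw
  split_ifs with h
  · exact (hw _ (by simpa using h)).le
  · exact le_rfl

lemma Phi1_eq (x : V → ℝ) : Phi1 G μ w x = (TV G w x / 2) / ∑ v, μ v * |x v| := by
  unfold Phi1 TV aw
  simp only [ite_mul, zero_mul]

lemma TV_ind (B : Finset V) : TV G w (indVec B) = 2 * bdryW G w B := by
  have h1 : ∀ u v, aw G w u v * |indVec B u - indVec B v| =
      (if u ∈ B then (if v ∈ Bᶜ then aw G w u v else 0) else 0) +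
      (if v ∈ B then (if u ∈ Bᶜ then aw G w v u else 0) else 0) := by
    intro u v
    rw [aw_symm G w v u]
    by_cases hu : u ∈ B <;> by_cases hv : v ∈ B <;> simp [indVec, hu, hv]
  have h2 : ∑ u, ∑ v, (if u ∈ B then (if v ∈ Bᶜ then aw G w u v else 0) else 0) = bdryW G w B := by
    unfold bdryW
    rw [← Finset.sum_filter_add_sum_filter_not Finset.univ (· ∈ B)]
    rw [Finset.sum_eq_zero (s := Finset.univ.filter (fun u => ¬ u ∈ B))]
    · rw [add_zero]
      simp only [Finset.filter_mem_eq_inter, Finset.univ_inter]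
      apply Finset.sum_congr rfl
      intro u hu
      simp only [hu, if_true]
      rw [← Finset.sum_filter]
      simp only [Finset.filter_mem_eq_inter, Finset.univ_inter]
      rfl
    · intro u hu
      simp only [Finset.mem_filter, Finset.mem_univ, true_and] at hu
      simp [hu]
  unfold TV
  simp only [h1, Finset.sum_add_distrib]
  rw [h2, Finset.sum_comm, h2]
  ring

lemma TV_add {x y z : V → ℝ} (h : ∀ u v, |x u - x v| = |y u - y v| + |z u - z v|) :
    TV G w x = TV G w y + TV G w z := by
  unfold TV
  simp only [h, mul_add, Finset.sum_add_distrib]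

lemma TV_nonneg (hw : ∀ e ∈ G.edgeSet, 0 < w e) (x : V → ℝ) : 0 ≤ TV G w x :=
  Finset.sum_nonneg fun u _ => Finset.sum_nonneg fun v _ =>
    mul_nonneg (aw_nonneg G w hw u v) (abs_nonneg _)

lemma layer {m : ℕ} (A : Fin m → Finset V) (φ₀ : ℝ)
    (hφ : ∀ I : Finset (Fin m), I.Nonempty → φ₀ * vol μ (I.biUnion A) ≤ bdryW G w (I.biUnion A))
    (N : ℕ) (y : V → ℝ) (hN : (Finset.univ.filter (fun v => 0 < y v)).card ≤ N) (hy : ∀ v, 0 ≤ y v)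
    (hA : ∀ i, ∀ u ∈ A i, ∀ v ∈ A i, y u = y v)
    (hout : ∀ v, (∀ i, v ∉ A i) → y v = 0) :
    φ₀ * ∑ v, μ v * y v ≤ TV G w y / 2 := by
  induction N generalizing y with
  | zero =>
    have hz : y = 0 := by
      funext v
      have : Finset.univ.filter (fun v => 0 < y v) = ∅ := by
        rw [← Finset.card_eq_zero]; omega
      have hv : ¬ 0 < y v := by
        intro h
        have : v ∈ Finset.univ.filter (fun v => 0 < y v) := by simp [h]
        rw [‹Finset.univ.filter (fun v => 0 < y v) = ∅›] at this
        simp at this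
      exact le_antisymm (not_lt.mp hv) (hy v)
    subst hz
    simp [TV]
  | succ N ih =>
    set B := Finset.univ.filter (fun v => 0 < y v) with hB
    rcases B.eq_empty_or_nonempty with he | hne
    · exact ih y (by rw [← hB, he]; simp) hy hA hout
    obtain ⟨v₀, hv₀, hmin⟩ := Finset.exists_min_image B y hne
    set t := y v₀ with ht
    have htpos : 0 < t := by simpa [hB] using hv₀
    have hBt : ∀ v ∈ B, t ≤ y v := hmin
    have hBn : ∀ v, v ∉ B → y v = 0 := by
      intro v hv
      have : ¬ 0 < y v := by simpa [hB] using hv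
      exact le_antisymm (not_lt.mp this) (hy v)
    classical
    set I := Finset.univ.filter (fun i => ∃ v ∈ A i, 0 < y v) with hI
    have hBI : B = I.biUnion A := by
      ext v
      simp only [hB, hI, Finset.mem_filter, Finset.mem_univ, true_and, Finset.mem_biUnion]
      constructor
      · intro hv
        by_contra! hcon
        have := hout v (fun i hi => hcon i ⟨v, hi, hv⟩ hi)
        linarith
      · rintro ⟨i, ⟨u, hu, hu0⟩, hv⟩
        rw [hA i v hv u hu]; exact hu0
    have hIne : I.Nonempty := by
      by_contra! hcon
      rw [hcon] at hBI
      simp at hBI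
      simp [hBI] at hne
    have hb := hφ I hIne
    rw [← hBI] at hb
    set z : V → ℝ := fun v => max (y v - t) 0 with hz
    have hyz : ∀ v, y v = t * indVec B v + z v := by
      intro v
      by_cases hv : v ∈ B
      · simp [indVec, hv, hz, hBt v hv]
      · simp [indVec, hv, hz, hBn v hv, htpos.le]
    have hzB : ∀ v, v ∉ B → z v = 0 := by
      intro v hv
      simp [hz, hBn v hv, htpos.le]
    have hz0 : ∀ v, 0 ≤ z v := fun v => le_max_right _ _
    have hlt : (Finset.univ.filter (fun v => 0 < z v)).card < B.card := by
      apply Finset.card_lt_card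
      refine ⟨?_, ?_⟩
      · intro v hv
        by_contra hvB
        have := hzB v hvB
        simp [this] at hv
      · intro hsub
        have := hsub hv₀
        simp [hz, ht] at this
    have ih' := ih z (by omega) hz0
      (fun i u hu v hv => by simp only [hz, hA i u hu v hv])
      (fun v hv => by simp [hz, hout v hv, htpos.le])
    have hTV : TV G w y = t * TV G w (indVec B) + TV G w z := by
      have : t * TV G w (indVec B) = TV G w (fun v => t * indVec B v) := by
        unfold TV
        simp only [Finset.mul_sum, ← mul_sub, abs_mul, abs_of_pos htpos]
        refine Finset.sum_congr rfl fun u _ => Finset.sum_congr rfl fun v _ => by ring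
      rw [this]
      apply TV_add
      intro u v
      rw [hyz u, hyz v]
      by_cases hu : u ∈ B <;> by_cases hv : v ∈ B
      · simp [indVec, hu, hv]
      · simp only [indVec, hu, hv, hzB v hv, if_true, if_false, mul_one, mul_zero, add_zero,
          sub_zero, abs_of_nonneg (hz0 u), abs_of_pos htpos]
        exact abs_of_nonneg (by linarith [hz0 u])
      · simp only [indVec, hu, hv, hzB u hu, if_true, if_false, mul_one, mul_zero, add_zero,
          zero_sub, abs_neg, abs_of_nonneg (hz0 v), abs_of_pos htpos]
        exact abs_of_nonneg (by linarith [hz0 v])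
      · simp [indVec, hu, hv]
    have hvol : ∑ v, μ v * y v = t * vol μ B + ∑ v, μ v * z v := by
      simp only [hyz, mul_add, Finset.sum_add_distrib]
      congr 1
      simp [vol, indVec, Finset.mul_sum, mul_comm]
    rw [hTV, hvol, TV_ind]
    have := mul_le_mul_of_nonneg_left hb htpos.le
    linarith

lemma vol_pos (hμ : ∀ v, 0 < μ v) (B : Finset V) (hB : B.Nonempty) : 0 < vol μ B :=
  Finset.sum_pos (fun v _ => hμ v) hB

lemma den_pos (hμ : ∀ v, 0 < μ v) (x : V → ℝ) (hx : x ≠ 0) : 0 < ∑ v, μ v * |x v| := by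
  obtain ⟨v, hv⟩ := Function.ne_iff.mp hx
  apply Finset.sum_pos'
  · intro i _; exact mul_nonneg (hμ i).le (abs_nonneg _)
  · exact ⟨v, Finset.mem_univ v, mul_pos (hμ v) (abs_pos.mpr hv)⟩

lemma selection (hμ : ∀ v, 0 < μ v) {m : ℕ} (A : Fin m → Finset V) (φ₀ : ℝ)
    (hφ : ∀ I : Finset (Fin m), I.Nonempty → φ₀ * vol μ (I.biUnion A) ≤ bdryW G w (I.biUnion A))
    (x : V → ℝ) (hx : x ≠ 0)
    (hA : ∀ i, ∀ u ∈ A i, ∀ v ∈ A i, x u = x v)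
    (hout : ∀ v, (∀ i, v ∉ A i) → x v = 0) : φ₀ ≤ Phi1 G μ w x := by
  rw [Phi1_eq, le_div_iff₀ (den_pos μ hμ x hx)]
  have h1 := layer G μ w A φ₀ hφ _ (fun v => max (x v) 0) le_rfl (fun v => le_max_right _ _)
    (fun i u hu v hv => by simp only [hA i u hu v hv])
    (fun v hv => by simp [hout v hv])
  have h2 := layer G μ w A φ₀ hφ _ (fun v => max (-x v) 0) le_rfl (fun v => le_max_right _ _)
    (fun i u hu v hv => by simp only [hA i u hu v hv])
    (fun v hv => by simp [hout v hv])
  have h3 : TV G w x = TV G w (fun v => max (x v) 0) + TV G w (fun v => max (-x v) 0) := by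
    apply TV_add
    intro u v
    rcases le_total (x u) 0 with hu | hu <;> rcases le_total (x v) 0 with hv | hv
    · rw [max_eq_right hu, max_eq_right hv, max_eq_left (by linarith), max_eq_left (by linarith)]
      rw [sub_self, abs_zero, zero_add, ← abs_neg]; congr 1; ring
    · rw [max_eq_right hu, max_eq_left hv, max_eq_left (by linarith), max_eq_right (by linarith)]
      rw [abs_of_nonpos (by linarith), abs_of_nonpos (by linarith), abs_of_nonneg (by linarith)]
      ring
    · rw [max_eq_left hu, max_eq_right hv, max_eq_right (by linarith), max_eq_left (by linarith)]
      rw [abs_of_nonneg (by linarith), abs_of_nonneg (by linarith), abs_of_nonpos (by linarith)]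
      ring
    · rw [max_eq_left hu, max_eq_left hv, max_eq_right (by linarith), max_eq_right (by linarith)]
      simp
  have h4 : ∑ v, μ v * |x v| = ∑ v, μ v * max (x v) 0 + ∑ v, μ v * max (-x v) 0 := by
    rw [← Finset.sum_add_distrib]
    apply Finset.sum_congr rfl
    intro v _
    rw [← mul_add]
    congr 1
    rcases le_total (x v) 0 with h | h
    · rw [abs_of_nonpos h, max_eq_right h, max_eq_left (by linarith)]; ring
    · rw [abs_of_nonneg h, max_eq_left h, max_eq_right (by linarith)]; ring
  rw [h3, h4]
  linarith

end sel

lemma bdryW_nonneg {V : Type*} [Fintype V] [DecidableEq V] (G : SimpleGraph V) [DecidableRel G.Adj]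
    (w : Sym2 V → ℝ) (hw : ∀ e ∈ G.edgeSet, 0 < w e) (B : Finset V) : 0 ≤ bdryW G w B :=
  Finset.sum_nonneg fun u _ => Finset.sum_nonneg fun v _ => aw_nonneg G w hw u v

end final

theorem lambdak_ge_ellk [Fintype V] [DecidableEq V] (G : SimpleGraph V) [DecidableRel G.Adj]
    (μ : V → ℝ) (w : Sym2 V → ℝ) (hμ : ∀ v, 0 < μ v) (hw : ∀ e ∈ G.edgeSet, 0 < w e)
    (k : ℕ) (hk : 1 ≤ k) (hkn : k ≤ Fintype.card V) :
    ellk G μ w k ≤ lambdak G μ w k := by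
  have hPhi0 : ∀ x, 0 ≤ Phi1 G μ w x := by
    intro x
    rw [Phi1_eq]
    have := TV_nonneg G w hw x
    have : 0 ≤ ∑ v, μ v * |x v| :=
      Finset.sum_nonneg fun v _ => mul_nonneg (hμ v).le (abs_nonneg _)
    positivity
  have hphi0 : ∀ B, 0 ≤ phi G μ w B := fun B =>
    div_nonneg (bdryW_nonneg G w hw B) (Finset.sum_nonneg fun v _ => (hμ v).le)
  unfold ellk lambdak
  apply Real.sSup_le
  swap
  · apply Real.sInf_nonneg
    rintro r ⟨S, -, -, -, rfl⟩
    apply Real.sSup_nonneg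
    rintro _ ⟨x, -, rfl⟩
    exact hPhi0 x
  rintro r ⟨A, ⟨hAne, hAd⟩, rfl⟩
  set φ₀ := sInf {s | ∃ I : Finset (Fin (Fintype.card V - k + 1)), I.Nonempty ∧
      s = phi G μ w (I.biUnion A)} with hφ₀
  have hφ : ∀ I : Finset (Fin (Fintype.card V - k + 1)), I.Nonempty →
      φ₀ * vol μ (I.biUnion A) ≤ bdryW G w (I.biUnion A) := by
    intro I hI
    have h1 : φ₀ ≤ phi G μ w (I.biUnion A) := by
      apply csInf_le
      · exact ⟨0, by rintro _ ⟨I, -, rfl⟩; exact hphi0 _⟩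
      · exact ⟨I, hI, rfl⟩
    have hne : (I.biUnion A).Nonempty := by
      obtain ⟨i, hi⟩ := hI
      obtain ⟨v, hv⟩ := hAne i
      exact ⟨v, Finset.mem_biUnion.mpr ⟨i, hi, hv⟩⟩
    exact (le_div_iff₀ (vol_pos μ hμ _ hne)).mp h1
  apply le_csInf
  · exact ⟨_, BU.l1sphere V, BU.l1_compact, fun x hx => BU.l1_neg hx,
      hkn.trans (genus_l1 (hk.trans hkn)), rfl⟩
  rintro r ⟨S, hSc, -, hSg, rfl⟩
  have h0S : (0 : V → ℝ) ∉ S := by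
    intro h
    have := genus_zero S h
    omega
  have hval : ∀ (c : Fin (Fintype.card V - k + 1) → ℝ) i, ∀ v ∈ A i,
      (∑ j, c j • indVec (A j)) v = c i := by
    intro c i v hv
    rw [Finset.sum_apply, Finset.sum_eq_single i]
    · simp [indVec, hv]
    · intro j _ hj
      have : v ∉ A j := fun h => (Finset.disjoint_left.mp (hAd j i hj)) h hv
      simp [indVec, this]
    · simp
  have hli : LinearIndependent ℝ (fun i => indVec (A i)) := by
    rw [Fintype.linearIndependent_iff]
    intro c hc i
    obtain ⟨v, hv⟩ := hAne i
    rw [← hval c i v hv, hc]; rfl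
  obtain ⟨x, hxS, hxU⟩ := genus_meets S k hk hSg
    (Submodule.span ℝ (Set.range fun i => indVec (A i))) (by
      rw [finrank_span_eq_card hli, Fintype.card_fin]; omega)
  obtain ⟨c, rfl⟩ := (Submodule.mem_span_range_iff_exists_fun ℝ).mp hxU
  have hxne : (∑ i, c i • indVec (A i)) ≠ 0 := fun h => h0S (h ▸ hxS)
  have hsel : φ₀ ≤ Phi1 G μ w (∑ i, c i • indVec (A i)) := by
    refine selection G μ w hμ A φ₀ hφ _ hxne ?_ ?_
    · intro i u hu v hv
      rw [hval c i u hu, hval c i v hv]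
    · intro v hv
      simp [Finset.sum_apply, indVec, hv]
  refine hsel.trans (le_csSup ?_ ⟨_, hxS, rfl⟩)
  apply IsCompact.bddAbove
  apply hSc.image_of_continuousOn
  have : Phi1 G μ w = fun x => (TV G w x / 2) / ∑ v, μ v * |x v| := funext (Phi1_eq G μ w)
  rw [this]
  apply ContinuousOn.div
  · unfold TV; fun_prop
  · fun_prop
  · intro x hx
    exact (den_pos μ hμ x (fun h => h0S (h ▸ hx))).ne'
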